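/- arXiv:2302.12140 — 4 statements merged into one kernel-verified Lean document; each statement's English description precedes it below -/
import Mathlib

section
/- Assume the number of voters n ≥ 4 is even, fix a preference relation ▷, and let D be a connected domain with D_C^▷ ⊆ D. Then every strategyproof and non-imposing SDS on D is ex post efficient. -/
open scoped Classical
open Finset

/-- A preference relation: a complete, transitive, and antisymmetric binary relation. -/
def IsPref {A : Type*} (r : A → A → Prop) : Prop :=
  (∀ x y : A, x ≠ y → r x y ∨ r y x) ∧
  (∀ x y z : A, r x y → r y z → r x z) ∧
  (∀ x y : A, r x y → ¬ r y x)

/-- A preference profile for `n` voters over alternatives `A`. -/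
abbrev Prof (n : ℕ) (A : Type*) := Fin n → A → A → Prop

/-- Every voter's relation is a preference relation. -/
def IsProf {n : ℕ} {A : Type*} (R : Prof n A) : Prop := ∀ i, IsPref (R i)

/-- The majority margin `g_R(x,y)`. -/
noncomputable def margin {n : ℕ} {A : Type*} (R : Prof n A) (x y : A) : ℤ :=
  (Nat.card {i : Fin n // R i x y} : ℤ) - (Nat.card {i : Fin n // R i y x} : ℤ)

/-- `x` is the Condorcet winner of `R`. -/
def CondorcetWinner {n : ℕ} {A : Type*} (R : Prof n A) (x : A) : Prop :=
  ∀ y, y ≠ x → 0 < margin R x y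

/-- The Condorcet domain: all profiles admitting a Condorcet winner. -/
def CondorcetDomain (n : ℕ) (A : Type*) : Set (Prof n A) :=
  {R | IsProf R ∧ ∃ x, CondorcetWinner R x}

/-- The `(n+1)`-voter profile `(R, ▷)` obtained from `R` by adding `t` as an extra voter. -/
def tieProf {n : ℕ} {A : Type*} (R : Prof n A) (t : A → A → Prop) : Prof (n + 1) A :=
  Fin.cons t R

/-- The tie-breaking Condorcet domain `D_C^▷`. -/
def TieCondorcetDomain (n : ℕ) {A : Type*} (t : A → A → Prop) : Set (Prof n A) :=
  {R | IsProf R ∧ ∃ x, CondorcetWinner (tieProf R t) x}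

/-- Upper contour set `U(≻, x)`. -/
def UC {A : Type*} (r : A → A → Prop) (x : A) : Set A := {y | r y x ∨ y = x}

/-- Probability that the lottery `p` assigns to the set `S`. -/
noncomputable def mass {A : Type*} [Fintype A] (p : A → ℝ) (S : Set A) : ℝ :=
  ∑ y, S.indicator p y

/-- Stochastic dominance `p ≿^SD q` w.r.t. the preference relation `r`. -/
def SDdom {A : Type*} [Fintype A] (r : A → A → Prop) (p q : A → ℝ) : Prop :=
  ∀ x, mass q (UC r x) ≤ mass p (UC r x)

/-- `f` is a social decision scheme on the domain `D`: on `D` it returns lotteries. -/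
def IsSDS {n : ℕ} {A : Type*} [Fintype A] (D : Set (Prof n A))
    (f : Prof n A → A → ℝ) : Prop :=
  ∀ R ∈ D, (∀ x, 0 ≤ f R x) ∧ (∑ x, f R x) = 1

/-- Strategyproofness of `f` on `D`. -/
def Strategyproof {n : ℕ} {A : Type*} [Fintype A] (D : Set (Prof n A))
    (f : Prof n A → A → ℝ) : Prop :=
  ∀ R ∈ D, ∀ R' ∈ D, ∀ i : Fin n,
    (∀ j, j ≠ i → R j = R' j) → SDdom (R i) (f R) (f R')

/-- Group-strategyproofness of `f` on `D`. -/
def GroupStrategyproof {n : ℕ} {A : Type*} [Fintype A] (D : Set (Prof n A))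
    (f : Prof n A → A → ℝ) : Prop :=
  ∀ R ∈ D, ∀ R' ∈ D, ∀ I : Finset (Fin n), I.Nonempty →
    (∀ j ∉ I, R j = R' j) → ∃ i ∈ I, SDdom (R i) (f R) (f R')

/-- Non-imposition of `f` on `D`. -/
def NonImposing {n : ℕ} {A : Type*} [Fintype A] (D : Set (Prof n A))
    (f : Prof n A → A → ℝ) : Prop :=
  ∀ x : A, ∃ R ∈ D, f R x = 1

/-- Ex post efficiency of `f` on `D`. -/
def ExPostEfficient {n : ℕ} {A : Type*} [Fintype A] (D : Set (Prof n A))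
    (f : Prof n A → A → ℝ) : Prop :=
  ∀ R ∈ D, ∀ x y : A, (∀ i, R i x y) → f R y = 0

/-- `x` is top-ranked by the preference relation `r`. -/
def TopRanked {A : Type*} (r : A → A → Prop) (x : A) : Prop := ∀ y, y ≠ x → r x y

/-- The dictatorship of voter `i`. -/
noncomputable def dict {n : ℕ} {A : Type*} [Fintype A] (i : Fin n) (R : Prof n A) : A → ℝ :=
  fun x => if TopRanked (R i) x then 1 else 0

/-- The Condorcet rule `COND`. -/
noncomputable def CondRule {n : ℕ} {A : Type*} [Fintype A] : Prof n A → A → ℝ :=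
  fun R x => if CondorcetWinner R x then 1 else 0

/-- The tie-breaking Condorcet rule `COND^▷`. -/
noncomputable def TieCondRule {n : ℕ} {A : Type*} [Fintype A] (t : A → A → Prop) :
    Prof n A → A → ℝ :=
  fun R x => if CondorcetWinner (tieProf R t) x then 1 else 0

/-- The relation obtained from `r` by swapping the (adjacent) alternatives `x ≻ y`. -/
def swapRel {A : Type*} (r : A → A → Prop) (x y : A) : A → A → Prop :=
  fun a b => (a = y ∧ b = x) ∨ (r a b ∧ ¬(a = x ∧ b = y))

/-- `R'` arises from `R` by letting voter `i` swap the adjacent alternatives `x ≻_i y`,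
i.e., `R' = R^{i:yx}`. -/
def AdjSwap {n : ℕ} {A : Type*} (R R' : Prof n A) (i : Fin n) (x y : A) : Prop :=
  x ≠ y ∧ R i x y ∧ (∀ z, z ≠ x → z ≠ y → ¬(R i x z ∧ R i z y)) ∧
  R' i = swapRel (R i) x y ∧ (∀ j, j ≠ i → R' j = R j)

/-- A single ad-path step inside `D`. -/
def Step {n : ℕ} {A : Type*} (D : Set (Prof n A)) (R R' : Prof n A) : Prop :=
  R ∈ D ∧ R' ∈ D ∧ ∃ i x y, AdjSwap R R' i x y

/-- A single ad-path step inside `D` in which the alternative `a` is not swapped. -/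
def StepAvoiding {n : ℕ} {A : Type*} (D : Set (Prof n A)) (a : A) (R R' : Prof n A) : Prop :=
  R ∈ D ∧ R' ∈ D ∧ ∃ i x y, AdjSwap R R' i x y ∧ x ≠ a ∧ y ≠ a

/-- There is an ad-path from `R` to `R'` inside `D`. -/
def AdPath {n : ℕ} {A : Type*} (D : Set (Prof n A)) (R R' : Prof n A) : Prop :=
  R ∈ D ∧ R' ∈ D ∧ Relation.ReflTransGen (Step D) R R'

/-- There is an ad-path from `R` to `R'` inside `D` along which `a` is never swapped. -/
def AdPathAvoiding {n : ℕ} {A : Type*} (D : Set (Prof n A)) (a : A) (R R' : Prof n A) : Prop :=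
  R ∈ D ∧ R' ∈ D ∧ Relation.ReflTransGen (StepAvoiding D a) R R'

/-- `D` is weakly connected. -/
def WeaklyConnected {n : ℕ} {A : Type*} (D : Set (Prof n A)) : Prop :=
  ∀ R ∈ D, ∀ R' ∈ D, AdPath D R R'

/-- `D` is connected. -/
def Connected {n : ℕ} {A : Type*} (D : Set (Prof n A)) : Prop :=
  WeaklyConnected D ∧
  ∀ a : A, ∀ R ∈ D, ∀ R' ∈ D, (∀ i, UC (R i) a = UC (R' i) a) → AdPathAvoiding D a R R'

/-- The relation that ranks `S` above its complement and agrees with `r` inside both parts. -/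
def raiseRel {A : Type*} (S : Set A) (r : A → A → Prop) : A → A → Prop :=
  fun a b => (a ∈ S ∧ b ∉ S) ∨ ((a ∈ S ↔ b ∈ S) ∧ r a b)

/-- The number of voters preferring `x` to `y`. -/
noncomputable def support {n : ℕ} {A : Type*} (R : Prof n A) (x y : A) : ℕ :=
  #{i | R i x y}

/-- `x` beats `y` under majority voting with ties broken by `t`. -/
def TieBeats {n : ℕ} {A : Type*} (t : A → A → Prop) (R : Prof n A) (x y : A) : Prop :=
  n < 2 * support R x y + if t x y then 1 else 0

/-- The profile in which the voters in `S` report as in `R'` and the others as in `R`. -/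
noncomputable def mixProf {n : ℕ} {A : Type*} (S : Finset (Fin n)) (R' R : Prof n A) : Prof n A :=
  fun i => if i ∈ S then R' i else R i

section Relations

variable {A : Type*} {r : A → A → Prop}

lemma IsPref.irrefl (hr : IsPref r) (a : A) : ¬ r a a := fun h => hr.2.2 a a h h

lemma IsPref.raiseRel (hr : IsPref r) (S : Set A) : IsPref (raiseRel S r) := by
  obtain ⟨h1, h2, h3⟩ := hr
  refine ⟨fun x y hxy => ?_, fun x y z hxy hyz => ?_, fun x y hxy hyx => ?_⟩
  · have := h1 x y hxy
    unfold _root_.raiseRel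
    tauto
  · have := h2 x y z
    unfold _root_.raiseRel at *
    tauto
  · have := h3 x y
    unfold _root_.raiseRel at *
    tauto

lemma raiseRel_singleton_top (r : A → A → Prop) {x y : A} (h : y ≠ x) :
    raiseRel {x} r x y := Or.inl ⟨rfl, h⟩

lemma UC_of_top (hr : IsPref r) {x : A} (h : TopRanked r x) : UC r x = {x} := by
  ext y
  refine ⟨fun hy => ?_, fun hy => Or.inr hy⟩
  rcases hy with hy | hy
  · by_contra hne
    exact hr.2.2 _ _ hy (h y hne)
  · exact hy

lemma UC_raiseRel_singleton (hr : IsPref r) {x y : A} (h : r x y) :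
    UC (raiseRel {x} r) y = UC r y := by
  have hyx : y ≠ x := fun e => hr.irrefl x (e ▸ h)
  ext a
  simp only [UC, raiseRel, Set.mem_ofPred_eq, Set.mem_singleton_iff]
  by_cases ha : a = x
  · subst ha; simp [h, hyx]
  · simp [ha, hyx]

lemma UC_raiseRel_UC (hr : IsPref r) (x y : A) (h : r x y) :
    UC (raiseRel (UC r x) (raiseRel {y} r)) x = UC r x := by
  have hxy : x ≠ y := fun e => hr.irrefl x (by rw [← e] at h; exact h)
  have h' := hr.2.2 _ _ h
  ext a
  simp only [UC, raiseRel, Set.mem_ofPred_eq, Set.mem_singleton_iff]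
  by_cases ha : a = y
  · subst ha; simp [h', hxy.symm]
  · simp only [ha, hxy]
    tauto

end Relations

section Lotteries

variable {A : Type*} [Fintype A] {r r' : A → A → Prop} {p q : A → ℝ}

lemma mass_mono (hp : ∀ x, 0 ≤ p x) {S T : Set A} (h : S ⊆ T) : mass p S ≤ mass p T :=
  Finset.sum_le_sum fun y _ => Set.indicator_le_indicator_of_subset h hp y

lemma mass_singleton (p : A → ℝ) (x : A) : mass p {x} = p x := by
  simp [mass, Set.indicator_apply]

lemma mass_univ (p : A → ℝ) : mass p Set.univ = ∑ x, p x := by simp [mass]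

lemma mass_insert (p : A → ℝ) {x : A} {S : Set A} (h : x ∉ S) :
    mass p (insert x S) = p x + mass p S := by
  rw [← mass_singleton p x, mass, mass, mass, ← Finset.sum_add_distrib]
  refine Finset.sum_congr rfl fun y _ => ?_
  rw [Set.insert_eq, Set.indicator_union_of_disjoint (by simpa using h)]

lemma mass_strict_le (hr : IsPref r) (h : SDdom r p q) (a : A) :
    mass q {b | r b a} ≤ mass p {b | r b a} := by
  rcases Set.eq_empty_or_nonempty {b | r b a} with he | hne
  · simp [he, mass]
  · have : IsTrans A (Function.swap r) := ⟨fun x y z hxy hyz => hr.2.1 _ _ _ hyz hxy⟩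
    have : Std.Irrefl (Function.swap r) := ⟨hr.irrefl⟩
    obtain ⟨z, hz, hmin⟩ :=
      (Finite.wellFounded_of_trans_of_irrefl (Function.swap r)).has_min _ hne
    have hUC : {b | r b a} = UC r z := by
      ext b
      refine ⟨fun hb => ?_, ?_⟩
      · by_cases hbz : b = z
        · exact Or.inr hbz
        · exact Or.inl ((hr.1 b z hbz).resolve_right (hmin b hb))
      · rintro (hb | rfl)
        · exact hr.2.1 _ _ _ hb hz
        · exact hz
    rw [hUC]
    exact h z

lemma mass_UC (hr : IsPref r) (p : A → ℝ) (a : A) :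
    mass p (UC r a) = p a + mass p {b | r b a} := by
  rw [← mass_insert p (S := {b | r b a}) (hr.irrefl a)]
  congr 1
  ext b
  simp only [UC, Set.mem_ofPred_eq, Set.mem_insert_iff]
  exact or_comm

lemma eq_of_SDdom_of_same_strict (hr : IsPref r) (hr' : IsPref r') {a : A}
    (hrr : ∀ b, r b a ↔ r' b a) (h : SDdom r p q) (h' : SDdom r' q p) : p a = q a := by
  have e : {b | r b a} = {b | r' b a} := Set.ext hrr
  have e' : UC r a = UC r' a := by
    ext b; simp [UC, hrr]
  have h1 := mass_strict_le hr h a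
  have h2 := mass_strict_le hr' h' a
  have h3 := h a
  have h4 := h' a
  have h5 := mass_UC hr p a
  have h6 := mass_UC hr q a
  rw [← e] at h2
  rw [← e'] at h4
  linarith

lemma eq_one_of_SDdom_of_UC_subset (hr : IsPref r) {x : A} (hUC : UC r' x ⊆ UC r x)
    (hp : ∀ y, 0 ≤ p y) (hp1 : ∑ y, p y = 1) (hq : ∀ y, 0 ≤ q y) (hq1 : ∑ y, q y = 1)
    (h : SDdom r p q) (h' : SDdom r' q p) (hx : p x = 1) : q x = 1 := by
  have hp0 : ∀ S : Set A, x ∉ S → mass p S = 0 := fun S hS => by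
    have h1 := mass_insert p hS
    have h2 := mass_mono hp (Set.subset_univ (insert x S))
    have h3 := mass_mono hp (Set.empty_subset S)
    rw [mass_univ] at h2
    have : mass p ∅ = 0 := by simp [mass]
    linarith
  have hzero : ∀ z, z ≠ x → q z = 0 := fun z hz => by
    refine le_antisymm ?_ (hq z)
    by_cases hzx : z ∈ UC r' x
    · have hrz : r z x := (hUC hzx).resolve_right hz
      have hxz : x ∉ UC r z := by
        rintro (hxz | hxz)
        · exact hr.2.2 _ _ hrz hxz
        · exact hz hxz.symm
      have h1 := h z
      rw [hp0 _ hxz] at h1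
      have h2 := mass_mono hq (S := {z}) (T := UC r z) (by rintro _ rfl; exact Or.inr rfl)
      rw [mass_singleton] at h2
      exact h2.trans h1
    · have h1 := h' x
      have h2 := mass_mono hp (S := {x}) (T := UC r' x) (by rintro _ rfl; exact Or.inr rfl)
      have h3 := mass_insert q hzx
      have h4 := mass_mono hq (Set.subset_univ (insert z (UC r' x)))
      rw [mass_singleton] at h2
      rw [mass_univ] at h4
      linarith
  rw [← hq1]
  exact (Finset.sum_eq_single x (fun z _ hz => hzero z hz) (by simp)).symm

end Lotteries

section Majority

variable {n : ℕ} {A : Type*} {R R' : Prof n A} {t : A → A → Prop}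

lemma support_mono {x y z w : A} (h : ∀ i, R i x y → R' i z w) :
    support R x y ≤ support R' z w :=
  Finset.card_le_card fun i hi => by
    simp only [Finset.mem_filter, Finset.mem_univ, true_and] at hi ⊢
    exact h i hi

lemma support_add_support (hR : IsProf R) {x y : A} (h : x ≠ y) :
    support R x y + support R y x = n := by
  have e : support R y x = #{i | ¬ R i x y} := by
    refine congrArg Finset.card (Finset.filter_congr fun i _ => ?_)
    exact ⟨fun h1 h2 => (hR i).2.2 _ _ h1 h2, fun h1 => ((hR i).1 _ _ h).resolve_left h1⟩
  rw [e, support, Finset.card_filter_add_card_filter_not]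
  simp

lemma support_eq_of_forall {x y : A} (h : ∀ i, R i x y) : support R x y = n := by
  simp [support, h]

lemma card_tieProf (R : Prof n A) (t : A → A → Prop) (x y : A) :
    Nat.card {i : Fin (n + 1) // tieProf R t i x y} =
      support R x y + if t x y then 1 else 0 := by
  rw [Nat.card_eq_fintype_card, Fintype.card_subtype, Fin.card_filter_univ_succ]
  simp only [tieProf, Fin.cons_zero, Fin.cons_succ, support]
  split_ifs <;> simp

lemma condorcetWinner_tieProf_iff (heven : Even n) (hR : IsProf R) (ht : IsPref t) (x : A) :
    CondorcetWinner (tieProf R t) x ↔ ∀ y, y ≠ x → TieBeats t R x y := by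
  refine forall_congr' fun y => forall_congr' fun hy => ?_
  obtain ⟨k, rfl⟩ := heven
  have h1 := support_add_support hR hy
  rw [margin, card_tieProf, card_tieProf, TieBeats]
  by_cases h : t x y
  · have h' := ht.2.2 _ _ h
    simp only [h, h', if_true, if_false]
    omega
  · have h' := (ht.1 _ _ hy).resolve_right h
    simp only [h, h', if_true, if_false]
    omega

lemma tieBeats_of_not (hR : IsProf R) (ht : IsPref t) {x y : A} (hy : y ≠ x)
    (h : ¬ TieBeats t R x y) : TieBeats t R y x := by
  have h1 := support_add_support hR hy
  unfold TieBeats at *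
  by_cases hxy : t x y
  · have h' := ht.2.2 _ _ hxy
    simp only [hxy, h', if_true, if_false] at *
    omega
  · have h' := (ht.1 _ _ hy).resolve_right hxy
    simp only [hxy, h', if_true, if_false] at *
    omega

lemma TieBeats.mono {x y : A} (h : TieBeats t R x y) (hRR : ∀ i, R i x y → R' i x y) :
    TieBeats t R' x y := by
  have := support_mono (z := x) (w := y) hRR
  unfold TieBeats at *
  omega

lemma tieBeats_of_forall (hn : 0 < n) {x y : A} (h : ∀ i, R i x y) : TieBeats t R x y := by
  rw [TieBeats, support_eq_of_forall h]
  omega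

lemma mem_tieCondorcetDomain (heven : Even n) (hR : IsProf R) (ht : IsPref t) {x : A}
    (h : ∀ y, y ≠ x → TieBeats t R x y) : R ∈ TieCondorcetDomain n t :=
  ⟨hR, x, (condorcetWinner_tieProf_iff heven hR ht x).2 h⟩

lemma mem_tieCondorcetDomain_of_top (hn : 0 < n) (heven : Even n) (hR : IsProf R)
    (ht : IsPref t) {x : A} (h : ∀ i, TopRanked (R i) x) : R ∈ TieCondorcetDomain n t :=
  mem_tieCondorcetDomain heven hR ht fun y hy => tieBeats_of_forall hn fun i => h i y hy

lemma mem_tieCondorcetDomain_of_top_two (hn : 0 < n) (heven : Even n) (hR : IsProf R)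
    (ht : IsPref t) {x y : A} (hyx : y ≠ x)
    (h : ∀ i z, z ≠ x → z ≠ y → R i x z ∧ R i y z) : R ∈ TieCondorcetDomain n t := by
  by_cases hxy : TieBeats t R x y
  · refine mem_tieCondorcetDomain heven hR ht (x := x) fun z hz => ?_
    by_cases hzy : z = y
    · exact hzy ▸ hxy
    · exact tieBeats_of_forall hn fun i => (h i z hz hzy).1
  · have hyx' := tieBeats_of_not hR ht hyx hxy
    refine mem_tieCondorcetDomain heven hR ht (x := y) fun z hz => ?_
    by_cases hzx : z = x
    · exact hzx ▸ hyx'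
    · exact tieBeats_of_forall hn fun i => (h i z hzx hz).2

lemma mixProf_induction {p : (A → A → Prop) → Fin n → Prop} {S : Finset (Fin n)}
    (h : ∀ i, p (R i) i) (h' : ∀ i, p (R' i) i) (i : Fin n) : p (mixProf S R' R i) i := by
  unfold mixProf
  split_ifs
  · exact h' i
  · exact h i

/-- If `y` is the tie-breaking-maximal alternative beating `x`, then pushing `y` up as far as
possible without changing the upper contour sets of `x` makes `y` beat everything. -/
lemma tieBeats_of_pushed (hR : IsProf R) (ht : IsPref t) {x y : A}
    (hyx : TieBeats t R y x) (hne : y ≠ x)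
    (hmax : ∀ z, z ≠ x → TieBeats t R z x → ¬ t z y)
    (htop : ∀ i z, z ≠ y → R i y x → R' i y z)
    (hbelow : ∀ i z, z ≠ y → R i x y → R i x z → R' i y z)
    {z : A} (hz : z ≠ y) : TieBeats t R' y z := by
  have h1 : support R y x ≤ support R' y z := support_mono fun i => htop i z hz
  by_contra hcon
  have hyx' := hyx
  unfold TieBeats at hyx hcon
  have htyz : ¬ t y z := fun h => by
    simp only [h, if_true] at hcon
    split_ifs at hyx <;> omega
  have htyx : t y x := by
    by_contra h
    simp only [h, htyz, if_false] at hcon hyx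
    omega
  have hzx : z ≠ x := by rintro rfl; exact htyz htyx
  have htzy : t z y := (ht.1 _ _ hz).resolve_right htyz
  have hnb : ¬ TieBeats t R z x := fun h => hmax z hzx h htzy
  have h2 : support R x z ≤ support R' y z := support_mono fun i hi => by
    rcases (hR i).1 y x hne with h | h
    · exact htop i z hz h
    · exact hbelow i z hz h hi
  have h3 := support_add_support hR hzx
  unfold TieBeats at hnb
  simp only [ht.2.1 _ _ _ htzy htyx, if_true] at hnb
  simp only [htyz, if_false] at hcon
  omega

end Majority

section Schemes

variable {n : ℕ} {A : Type*} [Fintype A] {D : Set (Prof n A)} {f : Prof n A → A → ℝ}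

lemma Strategyproof.eq_of_stepAvoiding (hsp : Strategyproof D f) (hD : ∀ R ∈ D, IsProf R)
    {R R' : Prof n A} {a : A} (h : StepAvoiding D a R R') : f R a = f R' a := by
  obtain ⟨hR, hR', i, x, y, ⟨-, -, -, hi, hj⟩, hx, hy⟩ := h
  refine eq_of_SDdom_of_same_strict (hD R hR i) (hD R' hR' i) (fun b => ?_)
    (hsp R hR R' hR' i fun j hji => (hj j hji).symm) (hsp R' hR' R hR i hj)
  simp [hi, swapRel, hx.symm, hy.symm]

lemma Strategyproof.eq_of_UC_eq (hsp : Strategyproof D f) (hD : ∀ R ∈ D, IsProf R)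
    (hconn : Connected D) {R R' : Prof n A} (hR : R ∈ D) (hR' : R' ∈ D) {a : A}
    (h : ∀ i, UC (R i) a = UC (R' i) a) : f R a = f R' a := by
  have hpath := (hconn.2 a R hR R' hR' h).2.2
  clear h hR'
  induction hpath with
  | refl => rfl
  | tail _ hstep ih => exact ih.trans (hsp.eq_of_stepAvoiding hD hstep)

/-- If all mixtures of `R` and `R'` are in the domain and `x` only gains from `R` to `R'`, then
`x` remains chosen with certainty. -/
lemma Strategyproof.eq_one_of_mixProf (hsp : Strategyproof D f) (hD : ∀ R ∈ D, IsProf R)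
    (hf : IsSDS D f) {R R' : Prof n A} {x : A} (hmix : ∀ S, mixProf S R' R ∈ D)
    (hUC : ∀ i, UC (R' i) x ⊆ UC (R i) x) (hx : f R x = 1) : f R' x = 1 := by
  have key : ∀ S : Finset (Fin n), f (mixProf S R' R) x = 1 := fun S => by
    induction S using Finset.induction_on with
    | empty =>
      have e : mixProf ∅ R' R = R := by funext i; simp [mixProf]
      rwa [e]
    | insert i S hi ih =>
      have hj : ∀ j, j ≠ i → mixProf S R' R j = mixProf (insert i S) R' R j := fun j hji => by
        simp [mixProf, hji]
      have h0 := hmix S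
      have h1 := hmix (insert i S)
      refine eq_one_of_SDdom_of_UC_subset (hD _ h0 i) ?_ (hf _ h0).1 (hf _ h0).2
        (hf _ h1).1 (hf _ h1).2 (hsp _ h0 _ h1 i hj)
        (hsp _ h1 _ h0 i fun j hji => (hj j hji).symm) ih
      simpa [mixProf, hi] using hUC i
  have e : mixProf Finset.univ R' R = R' := by funext i; simp [mixProf]
  rw [← e]
  exact key _

variable {t : A → A → Prop}

/-- If `x` is a tie-breaking Condorcet winner chosen with certainty, it is also chosen with
certainty at some profile where everyone top-ranks it. -/
lemma exists_top_of_winner (heven : Even n) (ht : IsPref t)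
    (hD : ∀ R ∈ D, IsProf R) (hDC : TieCondorcetDomain n t ⊆ D) (hf : IsSDS D f)
    (hsp : Strategyproof D f) {R : Prof n A} (hR : R ∈ D) {x : A}
    (hwin : ∀ y, y ≠ x → TieBeats t R x y) (hx : f R x = 1) :
    ∃ R' ∈ D, (∀ i, TopRanked (R' i) x) ∧ f R' x = 1 := by
  set R' : Prof n A := fun i => raiseRel {x} (R i) with hR'
  have hP := hD R hR
  have hP' : IsProf R' := fun i => (hP i).raiseRel _
  have htop : ∀ i, TopRanked (R' i) x := fun i y hy => raiseRel_singleton_top _ hy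
  have hmix : ∀ S, mixProf S R' R ∈ D := fun S =>
    hDC <| mem_tieCondorcetDomain heven
      (mixProf_induction (p := fun r _ => IsPref r) hP hP') ht (x := x) fun y hy =>
        (hwin y hy).mono <| mixProf_induction (p := fun r i => R i x y → r x y)
          (fun _ h => h) (fun i _ => htop i y hy)
  refine ⟨R', ?_, htop, hsp.eq_one_of_mixProf hD hf hmix (fun i => ?_) hx⟩
  · have := hmix Finset.univ
    rwa [show mixProf Finset.univ R' R = R' by funext i; simp [mixProf]] at this
  · rw [UC_of_top (hP' i) (htop i)]
    rintro _ rfl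
    exact Or.inr rfl

/-- If `x` is chosen with certainty although it is not a tie-breaking Condorcet winner, it is also
chosen with certainty at some profile where everyone top-ranks it. -/
lemma exists_top_of_not_winner (hn : 0 < n) (heven : Even n) (ht : IsPref t)
    (hD : ∀ R ∈ D, IsProf R) (hDC : TieCondorcetDomain n t ⊆ D) (hconn : Connected D)
    (hf : IsSDS D f) (hsp : Strategyproof D f) {R : Prof n A} (hR : R ∈ D) {x : A}
    (hwin : ¬ ∀ y, y ≠ x → TieBeats t R x y) (hx : f R x = 1) :
    ∃ R' ∈ D, (∀ i, TopRanked (R' i) x) ∧ f R' x = 1 := by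
  have hP := hD R hR
  push Not at hwin
  obtain ⟨y₀, hy₀, hy₀x⟩ := hwin
  have : IsTrans A t := ⟨ht.2.1⟩
  have : Std.Irrefl t := ⟨ht.irrefl⟩
  obtain ⟨y, ⟨hne, hyx⟩, hmax⟩ := (Finite.wellFounded_of_trans_of_irrefl t).has_min
    {z | z ≠ x ∧ TieBeats t R z x} ⟨y₀, hy₀, tieBeats_of_not hP ht hy₀ hy₀x⟩
  set R₁ : Prof n A := fun i =>
    if R i y x then raiseRel {y} (R i) else raiseRel (UC (R i) x) (raiseRel {y} (R i)) with hR₁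
  set R₂ : Prof n A := fun i =>
    if R i y x then raiseRel {y} (raiseRel {x} (R i)) else raiseRel {x} (raiseRel {y} (R i))
    with hR₂
  set R₃ : Prof n A := fun i => raiseRel {x} (raiseRel {y} (R i)) with hR₃
  have hP₁ : IsProf R₁ := fun i => by
    simp only [hR₁]; split_ifs
    · exact (hP i).raiseRel _
    · exact ((hP i).raiseRel _).raiseRel _
  have hP₂ : IsProf R₂ := fun i => by
    simp only [hR₂]; split_ifs <;> exact ((hP i).raiseRel _).raiseRel _
  have hP₃ : IsProf R₃ := fun i => ((hP i).raiseRel _).raiseRel _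
  have hnot : ∀ i, ¬ R i y x → R i x y := fun i h => ((hP i).1 _ _ hne).resolve_left h
  have hUC₁ : ∀ i, UC (R i) x = UC (R₁ i) x := fun i => by
    simp only [hR₁]; split_ifs with h
    · exact (UC_raiseRel_singleton (hP i) h).symm
    · exact (UC_raiseRel_UC (hP i) x y (hnot i h)).symm
  have hbeats₁ : ∀ z, z ≠ y → TieBeats t R₁ y z := fun z hz => by
    refine tieBeats_of_pushed hP ht hyx hne (fun z hzx hb => hmax z ⟨hzx, hb⟩) ?_ ?_ hz
    · intro i z hz h
      simp only [hR₁, h, if_true]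
      exact raiseRel_singleton_top _ hz
    · intro i z hz h hxz
      have h' := (hP i).2.2 _ _ h
      have hxz' := (hP i).2.2 _ _ hxz
      have hzx : z ≠ x := by rintro rfl; exact (hP i).irrefl _ hxz
      simp only [hR₁, h', if_false]
      refine Or.inr ⟨?_, raiseRel_singleton_top _ hz⟩
      simp [UC, h', hne, hxz', hzx]
  have hD₁ : R₁ ∈ D := hDC (mem_tieCondorcetDomain heven hP₁ ht hbeats₁)
  have hx₁ : f R₁ x = 1 := by rw [← hsp.eq_of_UC_eq hD hconn hR hD₁ hUC₁, hx]
  have hx₂ : f R₂ x = 1 := by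
    refine hsp.eq_one_of_mixProf hD hf (fun S => hDC ?_) (fun i => ?_) hx₁
    · refine mem_tieCondorcetDomain heven
        (mixProf_induction (p := fun r _ => IsPref r) hP₁ hP₂) ht (x := y) fun z hz =>
          (hbeats₁ z hz).mono <| mixProf_induction (p := fun r i => R₁ i y z → r y z)
            (fun _ h => h) (fun i h₁ => ?_)
      by_cases h : R i y x
      · simp only [hR₂, h, if_true]
        exact raiseRel_singleton_top _ hz
      · simp only [hR₂, h, if_false]
        have hzx : z ≠ x := by
          rintro rfl
          have hmem : y ∈ UC (R₁ i) z := Or.inl h₁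
          rw [← hUC₁ i] at hmem
          exact hmem.elim h hne
        exact Or.inr ⟨by simp [hne, hzx], raiseRel_singleton_top _ hz⟩
    · rw [← hUC₁ i]
      by_cases h : R i y x
      · rintro a (ha | rfl)
        · simp only [hR₂, h, if_true] at ha
          rcases ha with ⟨rfl, -⟩ | ⟨-, ⟨rfl, -⟩ | ⟨-, ha⟩⟩
          · exact Or.inl h
          · exact Or.inr rfl
          · exact Or.inl ha
        · exact Or.inr rfl
      · simp only [hR₂, h, if_false]
        rw [UC_of_top (((hP i).raiseRel _).raiseRel _)
          (fun z hz => raiseRel_singleton_top _ hz)]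
        rintro _ rfl
        exact Or.inr rfl
  have htop₃ : ∀ i, TopRanked (R₃ i) x := fun i z hz => raiseRel_singleton_top _ hz
  have hx₃ : f R₃ x = 1 := by
    refine hsp.eq_one_of_mixProf hD hf (fun S => hDC ?_) (fun i => ?_) hx₂
    · have htwo : ∀ (r : A → A → Prop) (a b z : A), z ≠ a → z ≠ b →
          raiseRel {a} (raiseRel {b} r) a z ∧ (b ≠ a → raiseRel {a} (raiseRel {b} r) b z) :=
        fun r a b z ha hb => ⟨raiseRel_singleton_top _ ha, fun hba =>
          Or.inr ⟨by simp [hba, ha], raiseRel_singleton_top _ hb⟩⟩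
      refine mem_tieCondorcetDomain_of_top_two hn heven
        (mixProf_induction (p := fun r _ => IsPref r) hP₂ hP₃) ht hne
        (mixProf_induction
          (p := fun r _ => ∀ z, z ≠ x → z ≠ y → r x z ∧ r y z) (fun i z hzx hzy => ?_)
          (fun i z hzx hzy => ?_))
      · simp only [hR₂]; split_ifs
        · exact ⟨(htwo _ _ _ _ hzy hzx).2 hne.symm, (htwo _ _ _ _ hzy hzx).1⟩
        · exact ⟨(htwo _ _ _ _ hzx hzy).1, (htwo _ _ _ _ hzx hzy).2 hne⟩
      · exact ⟨(htwo _ _ _ _ hzx hzy).1, (htwo _ _ _ _ hzx hzy).2 hne⟩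
    · rw [UC_of_top (hP₃ i) (htop₃ i)]
      rintro _ rfl
      exact Or.inr rfl
  exact ⟨R₃, hDC (mem_tieCondorcetDomain_of_top hn heven hP₃ ht htop₃), htop₃, hx₃⟩

/-- Strategyproof and non-imposing schemes choose unanimously top-ranked alternatives. -/
lemma eq_one_of_top (hn : 0 < n) (heven : Even n) (ht : IsPref t)
    (hD : ∀ R ∈ D, IsProf R) (hDC : TieCondorcetDomain n t ⊆ D) (hconn : Connected D)
    (hf : IsSDS D f) (hsp : Strategyproof D f) (hni : NonImposing D f)
    {R : Prof n A} (hR : R ∈ D) {x : A} (htop : ∀ i, TopRanked (R i) x) : f R x = 1 := by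
  obtain ⟨R₀, hR₀, hx₀⟩ := hni x
  obtain ⟨R', hR', htop', hx'⟩ : ∃ R' ∈ D, (∀ i, TopRanked (R' i) x) ∧ f R' x = 1 := by
    by_cases hwin : ∀ y, y ≠ x → TieBeats t R₀ x y
    · exact exists_top_of_winner heven ht hD hDC hf hsp hR₀ hwin hx₀
    · exact exists_top_of_not_winner hn heven ht hD hDC hconn hf hsp hR₀ hwin hx₀
  rw [hsp.eq_of_UC_eq hD hconn hR hR' fun i => ?_, hx']
  rw [UC_of_top (hD R hR i) (htop i), UC_of_top (hD R' hR' i) (htop' i)]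

end Schemes

/-- For even `n ≥ 4` and a connected domain `D ⊇ D_C^▷`, every strategyproof
and non-imposing SDS on `D` is ex post efficient. -/
theorem strategyproof_nonImposing_expost_tie {n : ℕ} {A : Type*} [Fintype A]
    (hn : 4 ≤ n) (heven : Even n) (hA : 3 ≤ Fintype.card A)
    (t : A → A → Prop) (ht : IsPref t)
    (D : Set (Prof n A)) (hDprof : ∀ R ∈ D, IsProf R)
    (hDC : TieCondorcetDomain n t ⊆ D) (hconn : Connected D)
    (f : Prof n A → A → ℝ) (hf : IsSDS D f)
    (hsp : Strategyproof D f) (hni : NonImposing D f) :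
    ExPostEfficient D f := by
  intro R hR x y hxy
  have hn0 : 0 < n := by omega
  have hP := hDprof R hR
  have hne : y ≠ x := by
    rintro rfl
    exact (hP ⟨0, hn0⟩).irrefl _ (hxy _)
  set R' : Prof n A := fun i => raiseRel {x} (R i) with hR'def
  have htop : ∀ i, TopRanked (R' i) x := fun i z hz => raiseRel_singleton_top _ hz
  have hR' : R' ∈ D := hDC <|
    mem_tieCondorcetDomain_of_top hn0 heven (fun i => (hP i).raiseRel _) ht htop
  have hx := eq_one_of_top hn0 heven ht hDprof hDC hconn hf hsp hni hR' htop
  rw [hsp.eq_of_UC_eq hDprof hconn hR hR'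
    fun i => (UC_raiseRel_singleton (hP i) (hxy i)).symm]
  obtain ⟨hnonneg, hsum⟩ := hf R' hR'
  have h1 := Finset.sum_le_sum_of_subset_of_nonneg (Finset.subset_univ {x, y})
    (fun z _ _ => hnonneg z)
  rw [Finset.sum_pair hne.symm, hsum, hx] at h1
  linarith [hnonneg y]
end

section
/- Let f be a strategyproof and ex post efficient SDS on a super Condorcet domain D (D_C ⊆ D), fix an alternative a, an alternative b ≠ a, and a set of voters I ⊆ N with |I| = ⌈(n+1)/2⌉. Then for every profile R in which every voter in I top-ranks a and every voter in N∖I top-ranks b, we have f(R,a) + f(R,b) = 1. -/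
open scoped Classical
open Finset

/-- The relation obtained from `r` by moving `x` to the top. -/
def liftTop {A : Type*} (r : A → A → Prop) (x : A) : A → A → Prop :=
  fun u v => v ≠ x ∧ (u = x ∨ r u v)

theorem topRanked_liftTop {A : Type*} (r : A → A → Prop) (x : A) :
    TopRanked (liftTop r x) x :=
  fun _ hy => ⟨hy, Or.inl rfl⟩

theorem IsPref.liftTop {A : Type*} {r : A → A → Prop} (hr : IsPref r) (x : A) :
    IsPref (liftTop r x) := by
  obtain ⟨h1, h2, h3⟩ := hr
  refine ⟨fun u v huv => ?_, fun u v w huv hvw => ?_, fun u v huv hvu => ?_⟩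
  · by_cases hu : u = x
    · exact Or.inl ⟨fun hv => huv (hu.trans hv.symm), Or.inl hu⟩
    · by_cases hv : v = x
      · exact Or.inr ⟨hu, Or.inl hv⟩
      · exact (h1 u v huv).imp (fun h => ⟨hv, Or.inr h⟩) (fun h => ⟨hu, Or.inr h⟩)
  · refine ⟨hvw.1, huv.2.imp_right fun h => h2 u v w h ?_⟩
    exact hvw.2.resolve_left huv.1
  · exact h3 u v (huv.2.resolve_left hvu.1) (hvu.2.resolve_left huv.1)

/-- If `x` is lifted to the top and then `y` above it, `x` beats everything but `y`. -/
theorem liftTop_liftTop_second {A : Type*} (r : A → A → Prop) {x y z : A}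
    (hzx : z ≠ x) (hzy : z ≠ y) : liftTop (liftTop r x) y x z :=
  ⟨hzy, Or.inr (topRanked_liftTop r x z hzx)⟩

theorem mass_UC_of_topRanked {A : Type*} [Fintype A] {r : A → A → Prop} (hr : IsPref r)
    {x : A} (hx : TopRanked r x) (p : A → ℝ) : mass p (UC r x) = p x := by
  have hUC : UC r x = {x} := by
    ext y
    simp only [UC, Set.mem_ofPred_eq, Set.mem_singleton_iff, or_iff_right_iff_imp]
    intro hy
    by_contra hne
    exact hr.2.2 y x hy (hx y hne)
  simp [mass, hUC, Set.indicator_apply]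

/-- An alternative top-ranked by a strict majority is the Condorcet winner. -/
theorem condorcetWinner_of_majority_topRanked {n : ℕ} {A : Type*} {R : Prof n A}
    (hR : IsProf R) {I : Finset (Fin n)} (hI : n < 2 * I.card) {a : A}
    (ha : ∀ i ∈ I, TopRanked (R i) a) : CondorcetWinner R a := by
  intro y hy
  have h1 : I.card ≤ Nat.card {i : Fin n // R i a y} := by
    rw [Nat.card_eq_fintype_card, Fintype.card_subtype]
    exact card_le_card fun i hi => by simpa using ha i hi y hy
  have h2 : Nat.card {i : Fin n // R i y a} ≤ Iᶜ.card := by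
    rw [Nat.card_eq_fintype_card, Fintype.card_subtype]
    refine card_le_card fun i hi => ?_
    rw [mem_compl]
    exact fun hiI => (hR i).2.2 y a (by simpa using hi) (ha i hiI y hy)
  have h3 := I.card_compl_add_card
  rw [Fintype.card_fin] at h3
  unfold margin
  omega

/-- A voter who keeps `x` on top cannot change the probability of `x`. -/
theorem Strategyproof.apply_eq_of_topRanked {n : ℕ} {A : Type*} [Fintype A]
    {D : Set (Prof n A)} {f : Prof n A → A → ℝ} (hsp : Strategyproof D f)
    {R R' : Prof n A} (hR : R ∈ D) (hR' : R' ∈ D) {i : Fin n}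
    (hp : IsPref (R i)) (hp' : IsPref (R' i)) (h : ∀ j, j ≠ i → R j = R' j) {x : A}
    (hx : TopRanked (R i) x) (hx' : TopRanked (R' i) x) : f R x = f R' x := by
  have h1 := hsp R hR R' hR' i h x
  have h2 := hsp R' hR' R hR i (fun j hj => (h j hj).symm) x
  rw [mass_UC_of_topRanked hp hx, mass_UC_of_topRanked hp hx] at h1
  rw [mass_UC_of_topRanked hp' hx', mass_UC_of_topRanked hp' hx'] at h2
  exact le_antisymm h2 h1

/-- Suppose each voter has a set of admissible preferences and `D` contains all admissible
profiles. If only voters who keep `x` on top move between two admissible profiles, the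
probability of `x` is unchanged. -/
theorem Strategyproof.apply_eq_of_forall_topRanked {n : ℕ} {A : Type*} [Fintype A]
    {D : Set (Prof n A)} {f : Prof n A → A → ℝ} (hsp : Strategyproof D f)
    (P : Fin n → (A → A → Prop) → Prop) (hP : ∀ i r, P i r → IsPref r)
    (hD : ∀ R : Prof n A, (∀ i, P i (R i)) → R ∈ D) (x : A) (R' : Prof n A)
    (hR' : ∀ i, P i (R' i)) (S : Finset (Fin n)) (R : Prof n A) (hR : ∀ i, P i (R i))
    (hx : ∀ i ∈ S, TopRanked (R i) x) (hx' : ∀ i ∈ S, TopRanked (R' i) x)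
    (h : ∀ i ∉ S, R i = R' i) : f R x = f R' x := by
  induction S using Finset.induction_on generalizing R with
  | empty => rw [funext fun i => h i (notMem_empty i)]
  | insert i S hi ih =>
    have hu : ∀ j, P j (Function.update R i (R' i) j) := by
      intro j
      rcases eq_or_ne j i with rfl | hj
      · simpa using hR' j
      · simpa [hj] using hR j
    have hstep : f R x = f (Function.update R i (R' i)) x :=
      hsp.apply_eq_of_topRanked (i := i) (hD _ hR) (hD _ hu) (hP i _ (hR i)) (hP i _ (hu i))
        (fun j hj => by simp [hj]) (hx i (mem_insert_self i S))
        (by simpa using hx' i (mem_insert_self i S))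
    rw [hstep]
    refine ih _ hu (fun j hj => ?_) (fun j hj => hx' j (mem_insert_of_mem hj)) (fun j hj => ?_)
    · have hji : j ≠ i := fun e => hi (e ▸ hj)
      simpa [hji] using hx j (mem_insert_of_mem hj)
    · rcases eq_or_ne j i with rfl | hji
      · simp
      · simpa [hji] using h j (by simp [hji, hj])

/-- If every alternative outside `{a, b}` is Pareto-dominated, then `a` and `b` receive all
the probability. -/
theorem ExPostEfficient.apply_add_apply_eq_one {n : ℕ} {A : Type*} [Fintype A]
    {D : Set (Prof n A)} {f : Prof n A → A → ℝ} (hppe : ExPostEfficient D f) (hf : IsSDS D f)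
    {R : Prof n A} (hR : R ∈ D) {a b : A} (hab : a ≠ b)
    (h : ∀ z, z ≠ a → z ≠ b → ∃ x, ∀ i, R i x z) : f R a + f R b = 1 := by
  rw [← (hf R hR).2, ← sum_pair hab]
  refine sum_subset (subset_univ _) fun z _ hz => ?_
  simp only [mem_insert, mem_singleton, not_or] at hz
  obtain ⟨x, hx⟩ := h z hz.1 hz.2
  exact hppe R hR x z hx

/-- If `f` is strategyproof and ex post efficient on a super Condorcet domain,
`|I| = ⌈(n+1)/2⌉`, all voters in `I` top-rank `a`, and all others top-rank `b ≠ a`, then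
`f(R,a) + f(R,b) = 1`. -/
theorem two_towers_probability_one {n : ℕ} {A : Type*} [Fintype A]
    (hn : 3 ≤ n) (hA : 3 ≤ Fintype.card A)
    (D : Set (Prof n A)) (hDprof : ∀ R ∈ D, IsProf R)
    (hDC : CondorcetDomain n A ⊆ D)
    (f : Prof n A → A → ℝ) (hf : IsSDS D f)
    (hsp : Strategyproof D f) (hppe : ExPostEfficient D f)
    (a b : A) (hab : a ≠ b)
    (I : Finset (Fin n)) (hI : I.card = ⌈((n : ℚ) + 1) / 2⌉₊) :
    ∀ R : Prof n A, IsProf R → (∀ i ∈ I, TopRanked (R i) a) →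
      (∀ i ∉ I, TopRanked (R i) b) → f R a + f R b = 1 := by
  intro R hR ha hb
  have hmaj : n < 2 * I.card := by
    have h : ((n : ℚ) + 1) / 2 ≤ I.card := hI ▸ Nat.le_ceil _
    have h' : (n : ℚ) < 2 * I.card := by linarith
    exact_mod_cast h'
  let P : Fin n → (A → A → Prop) → Prop := fun i r => IsPref r ∧ (i ∈ I → TopRanked r a)
  have hD : ∀ Q : Prof n A, (∀ i, P i (Q i)) → Q ∈ D := fun Q hQ =>
    hDC ⟨fun i => (hQ i).1, a, condorcetWinner_of_majority_topRanked (fun i => (hQ i).1) hmaj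
      fun i hi => (hQ i).2 hi⟩
  let ra : Prof n A := fun i => liftTop (liftTop (R i) b) a
  let rb : Prof n A := fun i => liftTop (liftTop (R i) a) b
  have hra : ∀ i, P i (ra i) := fun i =>
    ⟨((hR i).liftTop b).liftTop a, fun _ => topRanked_liftTop _ a⟩
  have hrb : ∀ i, i ∉ I → P i (rb i) := fun i hi =>
    ⟨((hR i).liftTop a).liftTop b, fun hi' => absurd hi' hi⟩
  have hRP : ∀ i, P i (R i) := fun i => ⟨hR i, ha i⟩
  let RI : Prof n A := fun i => if i ∈ I then ra i else R i
  let RJ : Prof n A := fun i => if i ∈ I then R i else rb i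
  let RIJ : Prof n A := fun i => if i ∈ I then ra i else rb i
  have hRI : ∀ i, P i (RI i) := fun i => by
    by_cases hi : i ∈ I
    · simpa only [RI, if_pos hi] using hra i
    · simpa only [RI, if_neg hi] using hRP i
  have hRJ : ∀ i, P i (RJ i) := fun i => by
    by_cases hi : i ∈ I
    · simpa only [RJ, if_pos hi] using hRP i
    · simpa only [RJ, if_neg hi] using hrb i hi
  have hRIJ : ∀ i, P i (RIJ i) := fun i => by
    by_cases hi : i ∈ I
    · simpa only [RIJ, if_pos hi] using hra i
    · simpa only [RIJ, if_neg hi] using hrb i hi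
  have hRIb : ∀ i, i ∉ I → TopRanked (RI i) b := fun i hi => by
    simpa only [RI, if_neg hi] using hb i hi
  have hRJb : ∀ i, i ∉ I → TopRanked (RJ i) b := fun i hi => by
    simpa only [RJ, if_neg hi] using topRanked_liftTop _ b
  have hRIJb : ∀ i, i ∉ I → TopRanked (RIJ i) b := fun i hi => by
    simpa only [RIJ, if_neg hi] using topRanked_liftTop _ b
  have key := hsp.apply_eq_of_forall_topRanked P (fun _ _ h => h.1) hD
  have e1 : f R a = f RI a := key a RI hRI I R hRP ha (fun i hi => (hRI i).2 hi)
    fun i hi => by simp only [RI, if_neg hi]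
  have e2 : f RJ a = f RIJ a := key a RIJ hRIJ I RJ hRJ (fun i hi => (hRJ i).2 hi)
    (fun i hi => (hRIJ i).2 hi) fun i hi => by simp only [RJ, RIJ, if_neg hi]
  have e3 : f R b = f RJ b := key b RJ hRJ Iᶜ R hRP (fun i hi => hb i (mem_compl.1 hi))
    (fun i hi => hRJb i (mem_compl.1 hi))
    fun i hi => by simp only [RJ, if_pos (not_not.1 (mt mem_compl.2 hi))]
  have e4 : f RI b = f RIJ b := key b RIJ hRIJ Iᶜ RI hRI (fun i hi => hRIb i (mem_compl.1 hi))
    (fun i hi => hRIJb i (mem_compl.1 hi))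
    fun i hi => by simp only [RI, RIJ, if_pos (not_not.1 (mt mem_compl.2 hi))]
  have sI : f RI a + f RI b = 1 :=
    hppe.apply_add_apply_eq_one hf (hD _ hRI) hab fun z hza hzb => ⟨b, fun i => by
      by_cases hi : i ∈ I
      · simpa only [RI, if_pos hi] using liftTop_liftTop_second (R i) hzb hza
      · exact hRIb i hi z hzb⟩
  have sJ : f RJ a + f RJ b = 1 :=
    hppe.apply_add_apply_eq_one hf (hD _ hRJ) hab fun z hza hzb => ⟨a, fun i => by
      by_cases hi : i ∈ I
      · exact (hRJ i).2 hi z hza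
      · simpa only [RJ, if_neg hi] using liftTop_liftTop_second (R i) hza hzb⟩
  have sIJ : f RIJ a + f RIJ b = 1 :=
    hppe.apply_add_apply_eq_one hf (hD _ hRIJ) hab fun z hza hzb => ⟨b, fun i => by
      by_cases hi : i ∈ I
      · simpa only [RIJ, if_pos hi] using liftTop_liftTop_second (R i) hzb hza
      · exact hRIJb i hi z hzb⟩
  linarith
end

section
/- If m = 3 and a profile R has a Condorcet winner c, then at least one voter top-ranks c in R. -/
open scoped Classical
open Finset

/-- If the majority margin of `x` over `y` is positive, a strict majority prefers `x` to `y`. -/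
theorem lt_two_mul_card_of_margin_pos {n : ℕ} {A : Type*} {R : Prof n A} (hR : IsProf R)
    {x y : A} (hxy : x ≠ y) (h : 0 < margin R x y) :
    n < 2 * #{i : Fin n | R i x y} := by
  have hcover : n ≤ #{i : Fin n | R i x y} + #{i : Fin n | R i y x} := by
    refine (card_fin n).symm.trans_le ?_
    refine (card_le_card fun i _ => ?_).trans (card_union_le _ _)
    simpa using (hR i).1 x y hxy
  simp only [margin, Nat.card_eq_fintype_card, Fintype.card_subtype] at h
  omega

/-- Two majority comparisons with positive margins are shared by a common voter. -/
theorem exists_pref_of_margin_pos {n : ℕ} {A : Type*} {R : Prof n A} (hR : IsProf R)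
    {x y z w : A} (hxy : x ≠ y) (hzw : z ≠ w) (h₁ : 0 < margin R x y) (h₂ : 0 < margin R z w) :
    ∃ i, R i x y ∧ R i z w := by
  have hx := lt_two_mul_card_of_margin_pos hR hxy h₁
  have hz := lt_two_mul_card_of_margin_pos hR hzw h₂
  obtain ⟨i, hi⟩ := inter_nonempty_of_card_lt_card_add_card
    (subset_univ {i : Fin n | R i x y}) (subset_univ {i : Fin n | R i z w})
    (by rw [card_univ, Fintype.card_fin]; omega)
  exact ⟨i, by simpa using hi⟩

/-- If `m = 3` and `R` has a Condorcet winner `c`, then some voter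
top-ranks `c`. -/
theorem condorcetWinner_topRanked_of_three {n : ℕ} {A : Type*} [Fintype A]
    (hn : 3 ≤ n) (hA : Fintype.card A = 3)
    (R : Prof n A) (hR : IsProf R) (c : A) (hc : CondorcetWinner R c) :
    ∃ i : Fin n, TopRanked (R i) c := by
  have hcard : #(univ.erase c) = 2 := by
    rw [card_erase_of_mem (mem_univ c), card_univ, hA]
  obtain ⟨a, b, -, hab⟩ := card_eq_two.mp hcard
  have hmem (y : A) : y ≠ c ↔ y = a ∨ y = b := by
    simpa using Finset.ext_iff.mp hab y
  have ha : a ≠ c := (hmem a).2 (Or.inl rfl)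
  have hb : b ≠ c := (hmem b).2 (Or.inr rfl)
  obtain ⟨i, hia, hib⟩ := exists_pref_of_margin_pos hR ha.symm hb.symm (hc a ha) (hc b hb)
  refine ⟨i, fun y hy => ?_⟩
  rcases (hmem y).1 hy with rfl | rfl
  · exact hia
  · exact hib
end

section
/- If the number of voters n ≥ 4 is even and m = 3, then the SDS f defined on the Condorcet domain by f(R) = Σ_{i∈N} (1/(n−1))·d_i(R) − (1/(n−1))·COND(R) is a well-defined SDS (all probabilities are nonnegative and sum to 1) that is non-imposing and strategyproof on D_C, and it is not a random dictatorship. -/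
open scoped Classical
open Finset

/-- A preference relation over finitely many alternatives has exactly one top alternative. -/
theorem IsPref.exists_topRanked_iff {A : Type*} [Finite A] [Nonempty A] {r : A → A → Prop}
    (h : IsPref r) : ∃ t, ∀ x, TopRanked r x ↔ x = t := by
  obtain ⟨hc, ht, ha⟩ := h
  have : IsTrans A r := ⟨ht⟩
  have : Std.Irrefl r := ⟨fun x hx => ha x x hx hx⟩
  obtain ⟨t, -, hmin⟩ := (Finite.wellFounded_of_trans_of_irrefl r).has_min Set.univ
    Set.univ_nonempty
  have htop : TopRanked r t := fun y hy => (hc y t hy).resolve_left (hmin y trivial)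
  refine ⟨t, fun x => ⟨fun hx => ?_, fun hx => hx ▸ htop⟩⟩
  by_contra hne
  exact ha _ _ (hx t (Ne.symm hne)) (htop x hne)

/-- Every alternative is the top alternative of some preference relation. -/
theorem exists_isPref_topRanked {A : Type*} [Finite A] (x : A) :
    ∃ r : A → A → Prop, IsPref r ∧ TopRanked r x := by
  obtain ⟨k, ⟨e⟩⟩ := Finite.exists_equiv_fin A
  refine ⟨fun a b => b ≠ x ∧ (a = x ∨ e a < e b), ⟨fun a b hab => ?_, ?_, ?_⟩, ?_⟩
  · have : e a ≠ e b := fun h => hab (e.injective h)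
    by_cases ha : a = x
    · exact Or.inl ⟨fun hb => hab (ha.trans hb.symm), Or.inl ha⟩
    · by_cases hb : b = x
      · exact Or.inr ⟨ha, Or.inl hb⟩
      · exact this.lt_or_gt.imp (fun h => ⟨hb, Or.inr h⟩) (fun h => ⟨ha, Or.inr h⟩)
  · rintro a b c ⟨hb, hab⟩ ⟨hc, hbc⟩
    exact ⟨hc, hab.imp_right fun h => h.trans (hbc.resolve_left hb)⟩
  · rintro a b ⟨hb, hab⟩ ⟨ha, hba⟩
    exact lt_asymm (hab.resolve_left ha) (hba.resolve_left hb)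
  · exact fun y hy => ⟨hy, Or.inl rfl⟩

/-- The voters preferring `x` to `y`. -/
noncomputable def supporters {n : ℕ} {A : Type*} (R : Prof n A) (x y : A) : Finset (Fin n) :=
  univ.filter fun i => R i x y

theorem mem_supporters {n : ℕ} {A : Type*} {R : Prof n A} {x y : A} {i : Fin n} :
    i ∈ supporters R x y ↔ R i x y := by
  simp [supporters]

theorem margin_eq_card_supporters_sub {n : ℕ} {A : Type*} (R : Prof n A) (x y : A) :
    margin R x y = ((supporters R x y).card : ℤ) - (supporters R y x).card := by
  simp only [margin, supporters, Nat.card_eq_fintype_card, Fintype.card_subtype]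

theorem IsProf.card_supporters_add {n : ℕ} {A : Type*} {R : Prof n A} (h : IsProf R) {x y : A}
    (hxy : x ≠ y) : (supporters R x y).card + (supporters R y x).card = n := by
  have hneg : supporters R y x = univ.filter fun i => ¬ R i x y := by
    ext i
    simp only [mem_supporters, mem_filter, mem_univ, true_and]
    exact ⟨(h i).2.2 y x, fun hn => ((h i).1 x y hxy).resolve_left hn⟩
  rw [hneg, supporters, card_filter_add_card_filter_not, card_univ, Fintype.card_fin]

theorem IsProf.condorcetWinner_iff {n : ℕ} {A : Type*} {R : Prof n A} (h : IsProf R) {x : A} :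
    CondorcetWinner R x ↔ ∀ y, y ≠ x → n < 2 * (supporters R x y).card := by
  refine forall₂_congr fun y hy => ?_
  have := h.card_supporters_add hy.symm
  rw [margin_eq_card_supporters_sub]
  omega

/-- Changing the relation of one voter loses at most one supporter. -/
theorem card_supporters_le_add_one {n : ℕ} {A : Type*} {R R' : Prof n A} {i : Fin n}
    (h : ∀ j, j ≠ i → R j = R' j) (x y : A) :
    (supporters R x y).card ≤ (supporters R' x y).card + 1 := by
  refine (card_le_card fun j hj => ?_).trans (card_insert_le i _)
  rw [mem_insert, mem_supporters]
  rw [mem_supporters] at hj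
  by_cases hji : j = i
  · exact Or.inl hji
  · exact Or.inr (h j hji ▸ hj)

/-- For an even number of voters, a single voter cannot change the Condorcet winner. -/
theorem CondorcetWinner.eq_of_forall_ne_eq {n : ℕ} {A : Type*} (heven : Even n)
    {R R' : Prof n A} (hR : IsProf R) (hR' : IsProf R') {i : Fin n}
    (h : ∀ j, j ≠ i → R j = R' j) {a b : A}
    (ha : CondorcetWinner R a) (hb : CondorcetWinner R' b) : a = b := by
  by_contra hab
  have h1 := hR.condorcetWinner_iff.1 ha b (Ne.symm hab)
  have h2 := hR'.condorcetWinner_iff.1 hb a hab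
  have h3 := card_supporters_le_add_one h a b
  have h4 := hR'.card_supporters_add hab
  obtain ⟨k, hk⟩ := heven
  omega

theorem CondorcetWinner.eq {n : ℕ} {A : Type*} {R : Prof n A} {a b : A}
    (ha : CondorcetWinner R a) (hb : CondorcetWinner R b) : a = b := by
  by_contra hab
  have h1 := ha b (Ne.symm hab)
  have h2 := hb a hab
  rw [margin_eq_card_supporters_sub] at h1 h2
  omega

theorem CondorcetWinner.condRule_eq {n : ℕ} {A : Type*} [Fintype A] {R : Prof n A} {a : A}
    (ha : CondorcetWinner R a) : CondRule R = fun x => if x = a then 1 else 0 := by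
  funext x
  exact if_congr ⟨fun hx => hx.eq ha, fun hx => hx ▸ ha⟩ rfl rfl

/-- With three alternatives, a Condorcet winner is top-ranked by some voter. -/
theorem CondorcetWinner.exists_topRanked {n : ℕ} {A : Type*} [Fintype A]
    (hA : Fintype.card A = 3) {R : Prof n A} (hR : IsProf R) {a : A}
    (ha : CondorcetWinner R a) : ∃ i, TopRanked (R i) a := by
  have hcard : (univ.erase a).card = 2 := by
    rw [card_erase_of_mem (mem_univ a), card_univ, hA]
  obtain ⟨y, z, -, hyz⟩ := card_eq_two.1 hcard
  have hmem : ∀ w, w ≠ a ↔ w = y ∨ w = z := fun w => by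
    simpa using Finset.ext_iff.1 hyz w
  have h1 := hR.condorcetWinner_iff.1 ha y ((hmem y).2 (Or.inl rfl))
  have h2 := hR.condorcetWinner_iff.1 ha z ((hmem z).2 (Or.inr rfl))
  have h3 := card_union_add_card_inter (supporters R a y) (supporters R a z)
  have h4 := card_le_univ (supporters R a y ∪ supporters R a z)
  rw [Fintype.card_fin] at h4
  obtain ⟨i, hi⟩ := card_pos.1 (show 0 < (supporters R a y ∩ supporters R a z).card by omega)
  simp only [mem_inter, mem_supporters] at hi
  refine ⟨i, fun w hw => ?_⟩
  rcases (hmem w).1 hw with rfl | rfl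
  exacts [hi.1, hi.2]

theorem dict_nonneg {n : ℕ} {A : Type*} [Fintype A] (i : Fin n) (R : Prof n A) (x : A) :
    0 ≤ dict i R x := by
  unfold dict
  split_ifs <;> norm_num

theorem sum_dict {n : ℕ} {A : Type*} [Fintype A] [Nonempty A] {R : Prof n A} {i : Fin n}
    (h : IsPref (R i)) : ∑ x, dict i R x = 1 := by
  obtain ⟨t, ht⟩ := h.exists_topRanked_iff
  simp [dict, ht]

/-- Dictatorships are strategyproof for the dictator. -/
theorem sdDom_dict {n : ℕ} {A : Type*} [Fintype A] [Nonempty A] {R R' : Prof n A} {i : Fin n}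
    (h : IsPref (R i)) (h' : IsPref (R' i)) : SDdom (R i) (dict i R) (dict i R') := by
  intro x
  obtain ⟨t, ht⟩ := h.exists_topRanked_iff
  have htop : t ∈ UC (R i) x := by
    by_cases hx : x = t
    · exact Or.inr hx.symm
    · exact Or.inl ((ht t).2 rfl x hx)
  have hle : mass (dict i R') (UC (R i) x) ≤ 1 := by
    rw [← sum_dict h']
    exact sum_le_sum fun y _ => Set.indicator_le_self' (fun y _ => dict_nonneg i R' y) y
  refine hle.trans ?_
  calc (1 : ℝ) = (UC (R i) x).indicator (dict i R) t := by
        rw [Set.indicator_of_mem htop, dict, if_pos ((ht t).2 rfl)]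
    _ ≤ mass (dict i R) (UC (R i) x) :=
        single_le_sum (f := fun y => (UC (R i) x).indicator (dict i R) y)
          (fun y _ => Set.indicator_nonneg (fun y _ => dict_nonneg i R y) y) (mem_univ t)

/-- If all voters but possibly one top-rank `x` and `n ≥ 4`, then `x` is the Condorcet winner. -/
theorem condorcetWinner_of_topRanked {n : ℕ} {A : Type*} (hn : 4 ≤ n) {R : Prof n A}
    (hR : IsProf R) {x : A} (i : Fin n) (h : ∀ j, j ≠ i → TopRanked (R j) x) :
    CondorcetWinner R x := by
  refine hR.condorcetWinner_iff.2 fun y hy => ?_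
  have hsub : univ.erase i ⊆ supporters R x y := fun j hj =>
    mem_supporters.2 (h j (ne_of_mem_erase hj) y hy)
  have hcard := card_le_card hsub
  rw [card_erase_of_mem (mem_univ i), card_univ, Fintype.card_fin] at hcard
  omega

/-- For even `n ≥ 4` and `m = 3`, the SDS
`f(R) = Σ_i (1/(n-1))·d_i(R) - (1/(n-1))·COND(R)` is a well-defined, non-imposing, and
strategyproof SDS on the Condorcet domain, and it is not a random dictatorship. -/
theorem negative_condorcet_weight_example {n : ℕ} {A : Type*} [Fintype A]
    (hn : 4 ≤ n) (heven : Even n) (hA : Fintype.card A = 3)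
    (f : Prof n A → A → ℝ)
    (hfdef : ∀ R x, f R x =
      (∑ i, (1 / ((n : ℝ) - 1)) * dict i R x) - (1 / ((n : ℝ) - 1)) * CondRule R x) :
    IsSDS (CondorcetDomain n A) f ∧ NonImposing (CondorcetDomain n A) f ∧
      Strategyproof (CondorcetDomain n A) f ∧
      ¬ ∃ γ : Fin n → ℝ, (∀ i, 0 ≤ γ i) ∧ ∑ i, γ i = 1 ∧
          ∀ R ∈ CondorcetDomain n A, ∀ x, f R x = ∑ i, γ i * dict i R x := by
  have hn' : (4 : ℝ) ≤ n := by exact_mod_cast hn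
  have hpos : 0 < (n : ℝ) - 1 := by linarith
  set c : ℝ := 1 / ((n : ℝ) - 1) with hc
  have hc0 : 0 < c := one_div_pos.2 hpos
  have hcn : n * c - c = 1 := by
    rw [hc]
    field_simp
  have hf : ∀ R x, f R x = c * ∑ i, dict i R x - c * CondRule R x := fun R x => by
    rw [hfdef, mul_sum]
  have : Nonempty A := Fintype.card_pos_iff.1 (by omega)
  have : Nontrivial A := Fintype.one_lt_card_iff_nontrivial.1 (by omega)
  refine ⟨?_, ?_, ?_, ?_⟩
  · rintro R ⟨hR, a, ha⟩
    refine ⟨fun x => ?_, ?_⟩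
    · rw [hf, ← mul_sub, ha.condRule_eq]
      refine mul_nonneg hc0.le (sub_nonneg.2 ?_)
      dsimp only
      split_ifs with hx
      · obtain ⟨i, hi⟩ := ha.exists_topRanked hA hR
        calc (1 : ℝ) = dict i R x := by rw [dict, if_pos (hx ▸ hi)]
          _ ≤ ∑ i, dict i R x :=
            single_le_sum (f := fun i => dict i R x) (fun i _ => dict_nonneg i R x) (mem_univ i)
      · exact sum_nonneg fun i _ => dict_nonneg i R x
    · simp_rw [hf, sum_sub_distrib, ← mul_sum]
      rw [sum_comm, sum_congr rfl fun i _ => sum_dict (hR i), ha.condRule_eq]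
      simp only [sum_const, card_univ, Fintype.card_fin, nsmul_eq_mul, mul_one, sum_ite_eq',
        mem_univ, if_true]
      linarith
  · intro x
    obtain ⟨r, hr, htop⟩ := exists_isPref_topRanked x
    have hR : IsProf fun _ : Fin n => r := fun _ => hr
    have hw := condorcetWinner_of_topRanked hn hR (x := x) ⟨0, by omega⟩ fun _ _ => htop
    refine ⟨_, ⟨hR, x, hw⟩, ?_⟩
    rw [hf, hw.condRule_eq]
    simp only [dict, if_pos htop, sum_const, card_univ, Fintype.card_fin, nsmul_eq_mul, mul_one,
      if_true]
    linarith
  · rintro R ⟨hR, a, ha⟩ R' ⟨hR', b, hb⟩ i h x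
    have hcond : CondRule R = CondRule R' := by
      rw [ha.condRule_eq, hb.condRule_eq, ha.eq_of_forall_ne_eq heven hR hR' h hb]
    have hrest : ∀ y, ∑ j ∈ univ.erase i, dict j R y = ∑ j ∈ univ.erase i, dict j R' y :=
      fun y => sum_congr rfl fun j hj => by
        simp only [dict, h j (ne_of_mem_erase hj)]
    have hdiff : ∀ y, f R y = f R' y + c * (dict i R y - dict i R' y) := fun y => by
      rw [hf, hf, hcond, ← add_sum_erase univ (fun j => dict j R y) (mem_univ i),
        ← add_sum_erase univ (fun j => dict j R' y) (mem_univ i), hrest]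
      ring
    have hmass : mass (f R) (UC (R i) x) = mass (f R') (UC (R i) x) +
        c * (mass (dict i R) (UC (R i) x) - mass (dict i R') (UC (R i) x)) := by
      simp only [mass]
      rw [← sum_sub_distrib, mul_sum, ← sum_add_distrib]
      refine sum_congr rfl fun y _ => ?_
      by_cases hy : y ∈ UC (R i) x
      · simp only [Set.indicator_of_mem hy, hdiff y]
      · simp only [Set.indicator_of_notMem hy, sub_zero, mul_zero, add_zero]
    rw [hmass]
    exact le_add_of_nonneg_right
      (mul_nonneg hc0.le (sub_nonneg.2 (sdDom_dict (hR i) (hR' i) x)))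
  · rintro ⟨γ, -, hγ, hrd⟩
    obtain ⟨x, y, hxy⟩ := exists_pair_ne A
    obtain ⟨r, hr, hrx⟩ := exists_isPref_topRanked x
    obtain ⟨s, hs, hsy⟩ := exists_isPref_topRanked y
    have hry : ¬ TopRanked r y := fun hy => hr.2.2 _ _ (hrx y hxy.symm) (hy x hxy)
    have hγc : ∀ i, γ i = c := fun i => by
      set R : Prof n A := fun j => if j = i then s else r with hRdef
      have hRj : ∀ j, j ≠ i → R j = r := fun j hj => if_neg hj
      have hRi : R i = s := if_pos rfl
      have hR : IsProf R := fun j => by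
        by_cases hj : j = i
        · rwa [hj, hRi]
        · rwa [hRj j hj]
      have hw := condorcetWinner_of_topRanked hn hR (x := x) i fun j hj => (hRj j hj).symm ▸ hrx
      have hd : ∀ j, dict j R y = if j = i then 1 else 0 := fun j => by
        by_cases hj : j = i
        · rw [hj, dict, hRi, if_pos hsy, if_pos rfl]
        · rw [dict, hRj j hj, if_neg hry, if_neg hj]
      have hfy := hrd R ⟨hR, x, hw⟩ y
      rw [hf, hw.condRule_eq] at hfy
      simpa [hd, hxy.symm] using hfy.symm
    simp only [hγc, sum_const, card_univ, Fintype.card_fin, nsmul_eq_mul] at hγ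
    linarith
end
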